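/- Define u : ℝ³ → ℝ³ by u(x) = exp(−(x₁² + x₂² + x₃²)) · ((1 − 2x₃²)x₁, (1 − 2x₃²)x₂, −2x₃ + 2(x₁² + x₂²)x₃). Then div u(x) = 0 for all x ∈ ℝ³. -/

import Mathlib

open Matrix MeasureTheory

/-- Partial derivative `∂ᵢ f` of a scalar field on `ℝ³`. -/
noncomputable def pd (i : Fin 3) (f : (Fin 3 → ℝ) → ℝ) (x : Fin 3 → ℝ) : ℝ :=
  fderiv ℝ f x (Pi.single i 1)

/-- The Jacobian matrix of `u : ℝ³ → ℝ³`, with entries `(Du)ᵢⱼ = ∂ᵢuⱼ`. -/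
noncomputable def jacobian (u : (Fin 3 → ℝ) → (Fin 3 → ℝ)) (x : Fin 3 → ℝ) :
    Matrix (Fin 3) (Fin 3) ℝ :=
  Matrix.of fun i j => pd i (fun y => u y j) x

/-- The strain matrix `∇_sym u = (1/2)(Du + Duᵀ)`. -/
noncomputable def strain (u : (Fin 3 → ℝ) → (Fin 3 → ℝ)) (x : Fin 3 → ℝ) :
    Matrix (Fin 3) (Fin 3) ℝ :=
  (1 / 2 : ℝ) • (jacobian u x + (jacobian u x)ᵀ)

/-- The divergence `div u = Σᵢ ∂ᵢuᵢ`. -/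
noncomputable def div3 (u : (Fin 3 → ℝ) → (Fin 3 → ℝ)) (x : Fin 3 → ℝ) : ℝ :=
  ∑ i, pd i (fun y => u y i) x

/-- The curl `curl u = (∂₂u₃−∂₃u₂, ∂₃u₁−∂₁u₃, ∂₁u₂−∂₂u₁)`. -/
noncomputable def curl3 (u : (Fin 3 → ℝ) → (Fin 3 → ℝ)) (x : Fin 3 → ℝ) : Fin 3 → ℝ :=
  ![pd 1 (fun y => u y 2) x - pd 2 (fun y => u y 1) x,
    pd 2 (fun y => u y 0) x - pd 0 (fun y => u y 2) x,
    pd 0 (fun y => u y 1) x - pd 1 (fun y => u y 0) x]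

/-- The explicit axisymmetric swirl-free velocity field
`u = (r − 2rz²)e^{−r²−z²} e_r + (−2z + 2r²z)e^{−r²−z²} e_z` in Cartesian coordinates. -/
noncomputable def uex (x : Fin 3 → ℝ) : Fin 3 → ℝ :=
  Real.exp (-(x 0 ^ 2 + x 1 ^ 2 + x 2 ^ 2)) •
    ![(1 - 2 * x 2 ^ 2) * x 0, (1 - 2 * x 2 ^ 2) * x 1,
      -2 * x 2 + 2 * (x 0 ^ 2 + x 1 ^ 2) * x 2]

theorem pd_apply (i j : Fin 3) (x : Fin 3 → ℝ) :
    pd i (fun y => y j) x = if j = i then 1 else 0 := by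
  have h : HasFDerivAt (fun y : Fin 3 → ℝ => y j)
      (ContinuousLinearMap.proj (R := ℝ) (φ := fun _ : Fin 3 => ℝ) j) x :=
    hasFDerivAt_apply j x
  rw [pd, h.fderiv]
  simp [Pi.single_apply]

theorem pd_const (i : Fin 3) (c : ℝ) (x : Fin 3 → ℝ) : pd i (fun _ => c) x = 0 := by
  simp [pd]

theorem pd_add (i : Fin 3) {f g : (Fin 3 → ℝ) → ℝ} {x : Fin 3 → ℝ}
    (hf : DifferentiableAt ℝ f x) (hg : DifferentiableAt ℝ g x) :
    pd i (fun y => f y + g y) x = pd i f x + pd i g x := by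
  simp [pd, fderiv_fun_add hf hg]

theorem pd_sub (i : Fin 3) {f g : (Fin 3 → ℝ) → ℝ} {x : Fin 3 → ℝ}
    (hf : DifferentiableAt ℝ f x) (hg : DifferentiableAt ℝ g x) :
    pd i (fun y => f y - g y) x = pd i f x - pd i g x := by
  simp [pd, fderiv_fun_sub hf hg]

theorem pd_neg (i : Fin 3) (f : (Fin 3 → ℝ) → ℝ) (x : Fin 3 → ℝ) :
    pd i (fun y => -f y) x = -pd i f x := by
  simp [pd, fderiv_fun_neg]

theorem pd_mul (i : Fin 3) {f g : (Fin 3 → ℝ) → ℝ} {x : Fin 3 → ℝ}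
    (hf : DifferentiableAt ℝ f x) (hg : DifferentiableAt ℝ g x) :
    pd i (fun y => f y * g y) x = f x * pd i g x + g x * pd i f x := by
  simp [pd, fderiv_fun_mul hf hg]

theorem pd_sq (i : Fin 3) {f : (Fin 3 → ℝ) → ℝ} {x : Fin 3 → ℝ}
    (hf : DifferentiableAt ℝ f x) :
    pd i (fun y => f y ^ 2) x = 2 * f x * pd i f x := by
  simp only [pow_two, pd_mul i hf hf]
  ring

theorem pd_exp (i : Fin 3) {f : (Fin 3 → ℝ) → ℝ} {x : Fin 3 → ℝ}
    (hf : DifferentiableAt ℝ f x) :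
    pd i (fun y => Real.exp (f y)) x = Real.exp (f x) * pd i f x := by
  simp [pd, fderiv_exp hf]

theorem uex_divergence_free : ∀ x : Fin 3 → ℝ, div3 uex x = 0 := by
  intro x
  simp only [div3, Fin.sum_univ_three, uex, Pi.smul_apply, smul_eq_mul, Matrix.cons_val]
  simp (disch := fun_prop) only [pd_mul, pd_exp, pd_neg, pd_add, pd_sub, pd_sq, pd_const,
    pd_apply]
  simp only [Fin.reduceEq, if_true, if_false]
  ring
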